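/- Set c = 0.9278 and L(n) = ⌊c·n⌋. There exist a real ε > 0 and a natural number N such that for all n ≥ N, P_{n,L(n)}(3-XOR-SAT) ≤ 1 − ε; i.e., at clause-to-variable ratio 0.9278 the probability of satisfiability of a random 3-XOR-formula is bounded away from 1. -/

import Mathlib

open Finset Filter

attribute [local instance] Classical.propDecidable

/-- A `k`-XOR-clause over `n` variables: a `k`-element set of variables
together with a right-hand side in `GF(2) = ZMod 2`. -/
abbrev Clause (n k : ℕ) := {S : Finset (Fin n) // S.card = k} × ZMod 2

/-- A formula in `Ω(n,L,k)`: an ordered `L`-tuple of `k`-XOR-clauses. -/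
abbrev Formula (n L k : ℕ) := Fin L → Clause n k

/-- A formula is satisfiable iff some assignment satisfies every clause. -/
def Satisfiable {n L k : ℕ} (F : Formula n L k) : Prop :=
  ∃ I : Fin n → ZMod 2, ∀ i : Fin L, ∑ j ∈ (F i).1.1, I j = (F i).2

/-- The number of satisfiable formulas in `Ω(n,L,k)`. -/
noncomputable def numSat (n L k : ℕ) : ℕ :=
  Nat.card {F : Formula n L k // Satisfiable F}

/-- `P_{n,L}(k-XOR-SAT)`: the fraction of satisfiable formulas in `Ω(n,L,k)`,
whose total number is `(2 * C(n,k))^L`. -/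
noncomputable def Psat (n L k : ℕ) : ℝ :=
  (numSat n L k : ℝ) / (2 * (n.choose k : ℝ)) ^ L

/-- The left-hand side of a system of XOR-clauses: a tuple of `k`-element sets of variables. -/
abbrev Support (n L k : ℕ) := Fin L → {S : Finset (Fin n) // S.card = k}

namespace Support

variable {n L k : ℕ}

/-- The right-hand sides for which the system with left-hand side `S` is solvable. -/
noncomputable def solvable (S : Support n L k) : Finset (Fin L → ZMod 2) :=
  univ.filter fun b => ∃ I : Fin n → ZMod 2, ∀ i, ∑ j ∈ (S i).1, I j = b i

/-- The variables occurring in no clause. -/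
noncomputable def isolated (S : Support n L k) : Finset (Fin n) :=
  univ.filter fun j => ∀ i, j ∉ (S i).1

/-- The variables occurring in clause `i` and in no other clause. -/
noncomputable def leaves (S : Support n L k) (i : Fin L) : Finset (Fin n) :=
  (S i).1.filter fun j => ∀ i', i' ≠ i → j ∉ (S i').1

/-- The variables occurring in at least two clauses. -/
noncomputable def core (S : Support n L k) : Finset (Fin n) :=
  univ.filter fun j => j ∉ S.isolated ∧ ∀ i, j ∉ S.leaves i

/-- The clauses containing a variable that occurs in no other clause. -/
noncomputable def touched (S : Support n L k) : Finset (Fin L) :=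
  univ.filter fun i => (S.leaves i).Nonempty

lemma mem_core_of_not_touched (S : Support n L k) {i : Fin L} (hi : i ∉ S.touched)
    {j : Fin n} (hj : j ∈ (S i).1) : j ∈ S.core := by
  simp only [core, touched, isolated, mem_filter, mem_univ, true_and] at hi ⊢
  refine ⟨fun h => h i hj, fun i' h => ?_⟩
  by_cases hii : i' = i
  · subst hii
    exact hi ⟨j, h⟩
  · exact (mem_filter.1 h).2 i (Ne.symm hii) hj

lemma card_solvable_le (S : Support n L k) :
    S.solvable.card ≤ 2 ^ (S.core.card + S.touched.card) := by
  have h : ∀ b : S.solvable, ∃ I : Fin n → ZMod 2, ∀ i, ∑ j ∈ (S i).1, I j = b.1 i :=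
    fun b => (mem_filter.1 b.2).2
  choose I hI using h
  let f : S.solvable → (S.core → ZMod 2) × (S.touched → ZMod 2) :=
    fun b => (fun j => I b j, fun i => b.1 i)
  have hf : Function.Injective f := by
    intro b b' hbb
    have h1 : ∀ j ∈ S.core, I b j = I b' j := fun j hj =>
      congrFun (congrArg Prod.fst hbb) ⟨j, hj⟩
    have h2 : ∀ i ∈ S.touched, b.1 i = b'.1 i := fun i hi =>
      congrFun (congrArg Prod.snd hbb) ⟨i, hi⟩
    refine Subtype.ext (funext fun i => ?_)
    by_cases hi : i ∈ S.touched
    · exact h2 i hi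
    · rw [← hI b i, ← hI b' i]
      exact sum_congr rfl fun j hj => h1 j (S.mem_core_of_not_touched hi hj)
  have := Fintype.card_le_of_injective f hf
  simpa [pow_add, ZMod.card] using this

lemma card_solvable_le_two_pow (S : Support n L k) : S.solvable.card ≤ 2 ^ L := by
  have := Finset.card_le_univ S.solvable
  simpa [ZMod.card] using this

lemma card_core_add (S : Support n L k) :
    S.core.card + S.isolated.card + ∑ i, (S.leaves i).card = n := by
  have hd : (↑(univ : Finset (Fin L)) : Set (Fin L)).PairwiseDisjoint S.leaves := by
    intro i _ i' _ hii
    refine Finset.disjoint_left.2 fun j hj hj' => ?_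
    exact (mem_filter.1 hj).2 i' (Ne.symm hii) (mem_filter.1 hj').1
  rw [← card_biUnion hd, ← card_union_of_disjoint, ← card_union_of_disjoint]
  · convert Finset.card_fin n
    ext j
    simp only [core, mem_union, mem_filter, mem_univ, true_and, mem_biUnion, iff_true]
    by_cases h : j ∈ S.isolated <;> by_cases h' : ∃ i, j ∈ S.leaves i <;> simp_all
  · refine Finset.disjoint_left.2 fun j hj hj' => ?_
    obtain ⟨i, -, hi⟩ := mem_biUnion.1 hj'
    rcases mem_union.1 hj with h | h
    · exact (mem_filter.1 h).2.2 i hi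
    · exact (mem_filter.1 h).2 i (mem_filter.1 hi).1
  · exact Finset.disjoint_left.2 fun j hj hj' => (mem_filter.1 hj).2.1 hj'

lemma card_touched (S : Support n L k) :
    S.touched.card = ∑ i, if (S.leaves i).card = 0 then 0 else 1 := by
  rw [touched, card_filter]
  refine sum_congr rfl fun i _ => ?_
  by_cases h : (S.leaves i).Nonempty
  · simp [h, h.ne_empty]
  · simp [not_nonempty_iff_eq_empty.1 h]

/-- A lower bound for the number of redundant clauses. -/
noncomputable def excess (S : Support n L k) : ℝ :=
  (L : ℝ) - n + S.isolated.card +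
    ∑ i, (((S.leaves i).card.choose 2 : ℝ) - ((S.leaves i).card.choose 3 : ℝ))

lemma excess_le (S : Support n L 3) :
    S.excess ≤ (L : ℝ) - (S.core.card + S.touched.card : ℕ) := by
  have h1 : (S.core.card : ℝ) + S.isolated.card + ∑ i, ((S.leaves i).card : ℝ) = n := by
    exact_mod_cast S.card_core_add
  have h2 : (S.touched.card : ℝ) =
      ∑ i, if (S.leaves i).card = 0 then (0 : ℝ) else 1 := by
    rw [S.card_touched]; push_cast; rfl
  have h3 : ∑ i, (((S.leaves i).card.choose 2 : ℝ) - ((S.leaves i).card.choose 3 : ℝ)) ≤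
      ∑ i, (((S.leaves i).card : ℝ) - if (S.leaves i).card = 0 then (0 : ℝ) else 1) := by
    refine sum_le_sum fun i _ => ?_
    have : (S.leaves i).card ≤ 3 := (card_filter_le _ _).trans (S i).2.le
    generalize (S.leaves i).card = d at this
    interval_cases d <;> norm_num [Nat.choose]
  rw [sum_sub_distrib (fun i => ((S.leaves i).card : ℝ))] at h3
  rw [excess]
  push_cast
  linarith

lemma card_solvable_div_le (S : Support n L 3) (hL : L ≤ n) (hn : 0 < n) :
    (S.solvable.card : ℝ) / 2 ^ L ≤ 1 - S.excess / (2 * n) := by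
  have hn' : (0 : ℝ) < n := by exact_mod_cast hn
  have he := S.excess_le
  rw [div_le_iff₀ (by positivity)]
  by_cases h : S.core.card + S.touched.card < L
  · have h1 : S.solvable.card * 2 ≤ 2 ^ L :=
      calc S.solvable.card * 2 ≤ 2 ^ (S.core.card + S.touched.card) * 2 :=
            Nat.mul_le_mul_right _ S.card_solvable_le
        _ = 2 ^ (S.core.card + S.touched.card + 1) := (pow_succ _ _).symm
        _ ≤ 2 ^ L := Nat.pow_le_pow_right (by norm_num) h
    have h2 : (S.solvable.card : ℝ) * 2 ≤ 2 ^ L := by exact_mod_cast h1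
    have h3 : S.excess / (2 * n) ≤ 1 / 2 := by
      rw [div_le_iff₀ (by positivity)]
      have : (L : ℝ) ≤ n := by exact_mod_cast hL
      have : (0 : ℝ) ≤ (S.core.card + S.touched.card : ℕ) := Nat.cast_nonneg _
      linarith
    have : (0 : ℝ) < 2 ^ L := by positivity
    nlinarith
  · have h1 : (S.solvable.card : ℝ) ≤ 2 ^ L := by exact_mod_cast S.card_solvable_le_two_pow
    have h2 : (L : ℝ) ≤ (S.core.card + S.touched.card : ℕ) := by exact_mod_cast not_lt.1 h
    have h3 : S.excess / (2 * n) ≤ 0 := div_nonpos_of_nonpos_of_nonneg (by linarith) (by positivity)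
    have : (0 : ℝ) < 2 ^ L := by positivity
    nlinarith

lemma card_filter_disjoint (P : Finset (Fin n)) :
    (univ.filter fun T : {S : Finset (Fin n) // S.card = k} => Disjoint T.1 P).card =
      (n - P.card).choose k := by
  have hP : (n - P.card) = Pᶜ.card := by rw [card_compl, Fintype.card_fin]
  rw [hP, ← card_powersetCard, ← card_map (Function.Embedding.subtype _)]
  congr 1
  ext T
  simp [mem_powersetCard, and_comm, subset_compl_iff_disjoint_right]

lemma sum_card_isolated :
    ∑ S : Support n L k, S.isolated.card = n * (n - 1).choose k ^ L := by
  simp_rw [isolated, card_filter]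
  rw [sum_comm]
  simp_rw [← card_filter]
  have : ∀ j : Fin n, (univ.filter fun S : Support n L k => ∀ i, j ∉ (S i).1).card =
      (n - 1).choose k ^ L := by
    intro j
    have h := card_filter_disjoint (k := k) {j}
    simp only [disjoint_singleton_right, card_singleton] at h
    rw [← h]
    have : (univ.filter fun S : Support n L k => ∀ i, j ∉ (S i).1) =
        Fintype.piFinset fun _ => univ.filter
          fun T : {S : Finset (Fin n) // S.card = k} => j ∉ T.1 := by
      ext S; simp [Fintype.mem_piFinset]
    rw [this, Fintype.card_piFinset]
    simp
  simp [this]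

lemma card_filter_subset_leaves (i : Fin L) (P : Finset (Fin n)) :
    (univ.filter fun S : Support n L k => P ⊆ S.leaves i).card =
      (univ.filter fun T : {S : Finset (Fin n) // S.card = k} => P ⊆ T.1).card *
        (n - P.card).choose k ^ (L - 1) := by
  have : (univ.filter fun S : Support n L k => P ⊆ S.leaves i) =
      Fintype.piFinset fun i' => if i' = i
        then univ.filter fun T : {S : Finset (Fin n) // S.card = k} => P ⊆ T.1
        else univ.filter fun T : {S : Finset (Fin n) // S.card = k} => Disjoint T.1 P := by
    ext S
    simp only [mem_filter, mem_univ, true_and, Fintype.mem_piFinset]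
    constructor
    · intro h i'
      by_cases hi : i' = i
      · subst hi
        simpa using h.trans (filter_subset _ _)
      · simp only [hi, if_false, mem_filter, mem_univ, true_and]
        exact Finset.disjoint_right.2 fun j hj => (mem_filter.1 (h hj)).2 i' hi
    · intro h j hj
      refine mem_filter.2 ⟨?_, fun i' hi => ?_⟩
      · have := h i
        simp only [if_true, mem_filter, mem_univ, true_and] at this
        exact this hj
      · have := h i'
        simp only [hi, if_false, mem_filter, mem_univ, true_and] at this
        exact Finset.disjoint_right.1 this hj
  rw [this, Fintype.card_piFinset, ← mul_prod_erase _ _ (mem_univ i), if_pos rfl,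
    ← card_filter_disjoint P]
  congr 1
  rw [prod_congr rfl fun i' hi' => by rw [if_neg (ne_of_mem_erase hi')], prod_const,
    card_erase_of_mem (mem_univ i), card_univ, Fintype.card_fin]

lemma sum_choose_card_leaves (i : Fin L) (m : ℕ) :
    ∑ S : Support n L k, (S.leaves i).card.choose m =
      n.choose k * k.choose m * (n - m).choose k ^ (L - 1) := by
  have h : ∀ A : Finset (Fin n), A.card.choose m =
      ∑ P ∈ powersetCard m univ, if P ⊆ A then 1 else 0 := by
    intro A
    rw [← card_filter, ← card_powersetCard]
    congr 1
    ext P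
    simp [mem_powersetCard, and_comm]
  have h' : ∑ P ∈ powersetCard m (univ : Finset (Fin n)),
      (univ.filter fun T : {S : Finset (Fin n) // S.card = k} => P ⊆ T.1).card =
      n.choose k * k.choose m := by
    simp_rw [card_filter]
    rw [sum_comm]
    simp_rw [← h]
    rw [sum_congr rfl fun T _ => by rw [T.2], sum_const, card_univ]
    simp [Fintype.card_finset_len]
  rw [sum_congr rfl fun S _ => h _, sum_comm, ← h', sum_mul]
  refine sum_congr rfl fun P hP => ?_
  rw [← card_filter, card_filter_subset_leaves, (mem_powersetCard.1 hP).2]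

lemma card_eq : Fintype.card (Support n L k) = n.choose k ^ L := by
  simp [Fintype.card_finset_len]

lemma sum_excess :
    ∑ S : Support n L 3, S.excess = ((L : ℝ) - n) * (n.choose 3 : ℝ) ^ L +
      n * ((n - 1).choose 3 : ℝ) ^ L +
      L * (n.choose 3 : ℝ) * (3 * ((n - 2).choose 3 : ℝ) ^ (L - 1) -
        ((n - 3).choose 3 : ℝ) ^ (L - 1)) := by
  have h0 : ∑ S : Support n L 3, (S.isolated.card : ℝ) = n * ((n - 1).choose 3 : ℝ) ^ L := by
    exact_mod_cast sum_card_isolated (n := n) (L := L) (k := 3)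
  have h1 (i : Fin L) (m : ℕ) : ∑ S : Support n L 3, ((S.leaves i).card.choose m : ℝ) =
      n.choose 3 * Nat.choose 3 m * ((n - m).choose 3 : ℝ) ^ (L - 1) := by
    exact_mod_cast sum_choose_card_leaves (n := n) (k := 3) i m
  simp only [excess, sum_add_distrib, h0]
  rw [sum_comm]
  simp only [sum_sub_distrib, h1, sum_const, card_univ, card_eq, Fintype.card_fin, nsmul_eq_mul]
  norm_num [Nat.choose]
  ring

end Support

lemma numSat_eq (n L k : ℕ) : numSat n L k = ∑ S : Support n L k, S.solvable.card := by
  have e : {F : Formula n L k // Satisfiable F} ≃ Σ S : Support n L k, S.solvable :=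
    { toFun := fun F => ⟨fun i => (F.1 i).1, fun i => (F.1 i).2, mem_filter.2 ⟨mem_univ _, F.2⟩⟩
      invFun := fun p => ⟨fun i => (p.1 i, p.2.1 i), (mem_filter.1 p.2.2).2⟩
      left_inv := fun F => rfl
      right_inv := fun p => rfl }
  rw [numSat, Nat.card_congr e, Nat.card_eq_fintype_card, Fintype.card_sigma]
  simp

lemma Psat_three_le {n L : ℕ} (hL : L ≤ n) (hL0 : 0 < L) (hn : 3 ≤ n) :
    Psat n L 3 ≤ 1 - ((L : ℝ) / n - 1 + (((n - 1).choose 3 : ℝ) / n.choose 3) ^ L +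
      (L : ℝ) / n * (3 * (((n - 2).choose 3 : ℝ) / n.choose 3) ^ (L - 1) -
        (((n - 3).choose 3 : ℝ) / n.choose 3) ^ (L - 1))) / 2 := by
  have hM : (0 : ℝ) < n.choose 3 := by exact_mod_cast Nat.choose_pos hn
  have hn' : (0 : ℝ) < n := by exact_mod_cast (by omega : 0 < n)
  have h := sum_le_sum fun (S : Support n L 3) (_ : S ∈ univ) =>
    S.card_solvable_div_le hL (by omega)
  rw [← sum_div, sum_sub_distrib, ← sum_div, Support.sum_excess, sum_const, card_univ,
    Support.card_eq] at h
  rw [Psat, numSat_eq, mul_pow, ← div_div, div_le_iff₀ (by positivity)]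
  push_cast at h ⊢
  refine h.trans_eq ?_
  obtain ⟨l, rfl⟩ : ∃ l, L = l + 1 := ⟨L - 1, by omega⟩
  simp only [Nat.add_sub_cancel, div_pow, nsmul_eq_mul]
  push_cast
  field_simp
  ring

lemma tendsto_one_add_pow_exp_mul {g : ℕ → ℝ} {m : ℕ → ℕ} {t c : ℝ}
    (hg : Tendsto (fun n : ℕ => n * g n) atTop (nhds t))
    (hm : Tendsto (fun n : ℕ => (m n : ℝ) / n) atTop (nhds c)) :
    Tendsto (fun n => (1 + g n) ^ m n) atTop (nhds (Real.exp (c * t))) := by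
  have hg0 : Tendsto g atTop (nhds 0) := by
    have := hg.mul (tendsto_inv_atTop_nhds_zero_nat (𝕜 := ℝ))
    rw [mul_zero] at this
    refine this.congr' ?_
    filter_upwards [eventually_gt_atTop 0] with n hn
    have : (n : ℝ) ≠ 0 := by exact_mod_cast hn.ne'
    field_simp
  have hlog := Real.tendsto_nat_mul_log_one_add_of_tendsto hg
  have := (Real.continuous_exp.tendsto _).comp (hm.mul hlog)
  refine this.congr' ?_
  filter_upwards [eventually_gt_atTop 0, hg0.eventually (lt_mem_nhds (by norm_num : (-1 : ℝ) < 0))]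
    with n hn hgn
  have : (n : ℝ) ≠ 0 := by exact_mod_cast hn.ne'
  have h1 : (0 : ℝ) < 1 + g n := by linarith
  rw [Function.comp_apply, ← mul_assoc, div_mul_cancel₀ _ this, mul_comm, Real.exp_mul,
    Real.exp_log h1, Real.rpow_natCast]

lemma cast_choose_three (n : ℕ) :
    (((n + 2).choose 3 : ℕ) : ℝ) = (n + 2) * (n + 1) * n / 6 := by
  have h := Nat.descFactorial_eq_factorial_mul_choose (n + 2) 3
  simp only [Nat.descFactorial, Nat.factorial] at h
  have h' : ((n : ℝ) + 2) * (n + 1) * n = 6 * ((n + 2).choose 3 : ℕ) := by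
    change n * ((n + 1) * ((n + 2) * 1)) = 6 * (n + 2).choose 3 at h
    have : (n + 2) * (n + 1) * n = 6 * (n + 2).choose 3 := by linarith
    exact_mod_cast this
  rw [h']; ring

lemma choose_three_ratio {n k : ℕ} (h : k + 3 ≤ n) :
    ((n - k).choose 3 : ℝ) / n.choose 3 =
      (1 + -k / ((n : ℝ) - 0)) * (1 + -k / ((n : ℝ) - 1)) * (1 + -k / ((n : ℝ) - 2)) := by
  obtain ⟨l, rfl⟩ : ∃ l, n = l + 1 + k + 2 := ⟨n - k - 3, by omega⟩
  rw [show l + 1 + k + 2 - k = l + 1 + 2 by omega, cast_choose_three, cast_choose_three]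
  push_cast
  have h0 : (l : ℝ) + 1 + k + 2 - 0 ≠ 0 := by ring_nf; positivity
  have h1 : (l : ℝ) + 1 + k + 2 - 1 ≠ 0 := by ring_nf; positivity
  have h2 : (l : ℝ) + 1 + k + 2 - 2 ≠ 0 := by ring_nf; positivity
  have h3 : (l : ℝ) + 1 + k + 2 ≠ 0 := by positivity
  have h4 : (l : ℝ) + 1 + k + 1 ≠ 0 := by positivity
  have h5 : (l : ℝ) + 1 + k ≠ 0 := by positivity
  rw [one_add_div h0, one_add_div h1, one_add_div h2]
  field_simp
  ring

lemma tendsto_mul_neg_div_sub (k a : ℝ) :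
    Tendsto (fun n : ℕ => (n : ℝ) * (-k / ((n : ℝ) - a))) atTop (nhds (-k)) := by
  have h := (tendsto_natCast_div_add_atTop (𝕜 := ℝ) (-a)).const_mul (-k)
  rw [mul_one] at h
  refine h.congr fun n => ?_
  rw [← sub_eq_add_neg]
  ring

lemma tendsto_choose_three_ratio_pow (k : ℕ) {m : ℕ → ℕ} {c : ℝ}
    (hm : Tendsto (fun n : ℕ => (m n : ℝ) / n) atTop (nhds c)) :
    Tendsto (fun n : ℕ => (((n - k).choose 3 : ℝ) / n.choose 3) ^ m n) atTop
      (nhds (Real.exp (-(3 * c)) ^ k)) := by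
  have h (a : ℝ) := tendsto_one_add_pow_exp_mul (tendsto_mul_neg_div_sub k a) hm
  have h3 := ((h 0).mul (h 1)).mul (h 2)
  have he : Real.exp (c * -k) * Real.exp (c * -k) * Real.exp (c * -k) =
      Real.exp (-(3 * c)) ^ k := by
    rw [← Real.exp_add, ← Real.exp_add, ← Real.exp_nat_mul]
    ring_nf
  rw [he] at h3
  refine h3.congr' ?_
  filter_upwards [eventually_ge_atTop (k + 3)] with n hn
  rw [choose_three_ratio hn, mul_pow, mul_pow]

lemma lt_exp_neg : (0.0618 : ℝ) < Real.exp (-(3 * 0.9278)) := by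
  have h1 : Real.exp 3 < 20.0856 := by
    have h := Real.exp_one_lt_d9
    rw [show (3 : ℝ) = (3 : ℕ) * 1 by norm_num, Real.exp_nat_mul]
    exact (pow_lt_pow_left₀ h (Real.exp_pos _).le (by norm_num)).trans (by norm_num)
  have h2 : (1.2417 : ℝ) < Real.exp 0.2166 := by
    refine lt_of_lt_of_le ?_ (Real.sum_le_exp_of_nonneg (by norm_num) 4)
    norm_num [sum_range_succ, Nat.factorial]
  rw [show (-(3 * 0.9278) : ℝ) = 0.2166 - 3 by norm_num, Real.exp_sub, lt_div_iff₀ (Real.exp_pos _)]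
  linarith

lemma limit_pos {p : ℝ} (h : 0.0618 < p) (h1 : p ≤ 1) :
    (0 : ℝ) < 0.9278 - 1 + p ^ 1 + 0.9278 * (3 * p ^ 2 - p ^ 3) := by
  have : (0 : ℝ) ≤ (p - 0.0618) * (3 * (p + 0.0618) - (p ^ 2 + 0.0618 * p + 0.0618 ^ 2)) :=
    mul_nonneg (by linarith) (by nlinarith)
  nlinarith

/-- At ratio `c = 0.9278` the probability of satisfiability of a random
3-XOR-formula is bounded away from `1`; i.e. `β_3 < 0.9278`. -/
theorem beta_three_lt :
    ∃ ε : ℝ, 0 < ε ∧ ∃ N : ℕ, ∀ n : ℕ, N ≤ n →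
      Psat n ⌊(0.9278 : ℝ) * n⌋₊ 3 ≤ 1 - ε := by
  set L : ℕ → ℕ := fun n => ⌊(0.9278 : ℝ) * n⌋₊
  have hL : Tendsto (fun n : ℕ => (L n : ℝ) / n) atTop (nhds 0.9278) :=
    (tendsto_nat_floor_mul_div_atTop (by norm_num)).comp tendsto_natCast_atTop_atTop
  have hL' : Tendsto (fun n : ℕ => ((L n - 1 : ℕ) : ℝ) / n) atTop (nhds 0.9278) := by
    have h := hL.sub (tendsto_inv_atTop_nhds_zero_nat (𝕜 := ℝ))
    rw [sub_zero] at h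
    refine h.congr' ?_
    filter_upwards [eventually_ge_atTop 2] with n hn
    have : 1 ≤ L n := Nat.le_floor (by
      have : (2 : ℝ) ≤ n := by exact_mod_cast hn
      push_cast
      linarith)
    rw [Nat.cast_sub this]
    push_cast
    ring
  have h1 := tendsto_choose_three_ratio_pow 1 hL
  have h2 := tendsto_choose_three_ratio_pow 2 hL'
  have h3 := tendsto_choose_three_ratio_pow 3 hL'
  have hlim := ((hL.sub_const 1).add h1).add (hL.mul ((h2.const_mul 3).sub h3))
  have hpos := limit_pos lt_exp_neg (Real.exp_le_one_iff.2 (by norm_num))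
  set δ := (0.9278 : ℝ) - 1 + Real.exp (-(3 * 0.9278)) ^ 1 +
    0.9278 * (3 * Real.exp (-(3 * 0.9278)) ^ 2 - Real.exp (-(3 * 0.9278)) ^ 3)
  obtain ⟨N, hN⟩ := eventually_atTop.1 (hlim.eventually (lt_mem_nhds (half_lt_self hpos)))
  refine ⟨δ / 4, by positivity, max N 3, fun n hn => ?_⟩
  have hn3 : 3 ≤ n := (le_max_right _ _).trans hn
  have hn3' : (3 : ℝ) ≤ n := by exact_mod_cast hn3
  have hle : L n ≤ n := Nat.floor_le_of_le (by linarith)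
  have hL0 : 0 < L n := Nat.floor_pos.2 (by linarith)
  have := hN n ((le_max_left _ _).trans hn)
  refine (Psat_three_le hle hL0 hn3).trans ?_
  linarith
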